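/- Every finite k-player game has a Nash equilibrium in mixed strategies. -/

import Mathlib

/-- A mixed strategy: a probability distribution on a finite set of pure strategies. -/
def IsMixed {σ : Type*} [Fintype σ] (x : σ → ℝ) : Prop :=
  (∀ a, 0 ≤ x a) ∧ ∑ a, x a = 1

/-- A mixed-strategy profile: one mixed strategy per player. -/
def IsProfile {k : ℕ} {S : Fin k → Type*} [∀ i, Fintype (S i)]
    (x : ∀ i, S i → ℝ) : Prop := ∀ i, IsMixed (x i)

/-- Player's expected payoff under a mixed-strategy profile:
`U(x) = Σ_{s ∈ S_1 × ⋯ × S_k} u(s) ∏_{r} x^r(s_r)`. -/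
noncomputable def expectedPayoff {k : ℕ} {S : Fin k → Type*} [∀ i, Fintype (S i)]
    (u : (∀ i, S i) → ℝ) (x : ∀ i, S i → ℝ) : ℝ :=
  ∑ s : ∀ i, S i, u s * ∏ i, x i (s i)

/-- Nash equilibrium: no player can improve his expected payoff by a unilateral
deviation to any mixed strategy. -/
def IsNashEquilibrium {k : ℕ} {S : Fin k → Type*} [∀ i, Fintype (S i)]
    (u : ∀ i : Fin k, (∀ i, S i) → ℝ) (x : ∀ i, S i → ℝ) : Prop :=
  ∀ (i : Fin k) (y : S i → ℝ), IsMixed y →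
    expectedPayoff (u i) (Function.update x i y) ≤ expectedPayoff (u i) x

/-- Scarf dominance. -/
def Dom {I V : Type*} (r : I → V → ℕ) (X : Finset V) : Prop :=
  ∀ y, ∃ i, ∀ x ∈ X, r i y ≤ r i x

theorem Dom.mono {I V : Type*} {r : I → V → ℕ} {X Y : Finset V} (h : Dom r X) (hYX : Y ⊆ X) :
    Dom r Y := fun y => by
  obtain ⟨i, hi⟩ := h y
  exact ⟨i, fun x hx => hi x (hYX hx)⟩

theorem exists_argmin {I V : Type*} (r : I → V → ℕ) {Y : Finset V} (hY : Y.Nonempty) :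
    ∃ m : I → V, (∀ i, m i ∈ Y) ∧ ∀ i, ∀ x ∈ Y, r i (m i) ≤ r i x := by
  have : ∀ i, ∃ v ∈ Y, ∀ x ∈ Y, r i v ≤ r i x := fun i => Finset.exists_min_image Y (r i) hY
  choose m h1 h2 using this
  exact ⟨m, h1, h2⟩

theorem Dom.surj {I V : Type*} {r : I → V → ℕ} (hinj : ∀ i, Function.Injective (r i))
    {Y : Finset V} (h : Dom r Y) {m : I → V} (m1 : ∀ i, m i ∈ Y)
    (m2 : ∀ i, ∀ x ∈ Y, r i (m i) ≤ r i x) {y : V} (hy : y ∈ Y) : ∃ i, m i = y := by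
  obtain ⟨i, hi⟩ := h y
  exact ⟨i, hinj i (le_antisymm (m2 i y hy) (hi _ (m1 i)))⟩

theorem door_pair {I V : Type*} [Fintype I] [DecidableEq I] [Fintype V] [DecidableEq V]
    {r : I → V → ℕ} (hinj : ∀ i, Function.Injective (r i))
    {Y : Finset V} (hY : Dom r Y) (hcard : Y.card + 1 = Fintype.card I)
    {m : I → V} (m1 : ∀ i, m i ∈ Y) (m2 : ∀ i, ∀ x ∈ Y, r i (m i) ≤ r i x) :
    ∃ a b, a ≠ b ∧ m a = m b := by
  have : ¬ Function.Injective m := by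
    intro hm
    have := Finset.card_le_card_of_injOn (s := Finset.univ) (t := Y) m (fun i _ => m1 i) hm.injOn
    rw [Finset.card_univ] at this
    omega
  simp only [Function.Injective] at this
  push Not at this
  obtain ⟨a, b, h, hn⟩ := this
  exact ⟨a, b, hn, h⟩

theorem door_of_max {I V : Type*} [Fintype I] [DecidableEq I] [Fintype V] [DecidableEq V]
    {r : I → V → ℕ} (hinj : ∀ i, Function.Injective (r i))
    {Y : Finset V} (hY : Dom r Y) (hcard : Y.card + 1 = Fintype.card I)
    {m : I → V} (m1 : ∀ i, m i ∈ Y) (m2 : ∀ i, ∀ x ∈ Y, r i (m i) ≤ r i x)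
    {a b : I} (hab : a ≠ b) (hm : m a = m b) {y : V}
    (hy : ∀ i, i ≠ a → r i (m i) < r i y)
    (hmax : ∀ z, (∀ i, i ≠ a → r i (m i) < r i z) → r a z ≤ r a y) :
    y ∉ Y ∧ Dom r (insert y Y) := by
  refine ⟨fun hyY => ?_, fun z => ?_⟩
  · obtain ⟨i, rfl⟩ := hY.surj hinj m1 m2 hyY
    by_cases h : i = a
    · subst h
      have := hy b hab.symm
      rw [hm] at this; exact lt_irrefl _ this
    · exact lt_irrefl _ (hy i h)
  · by_cases hz : ∀ i, i ≠ a → r i (m i) < r i z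
    · refine ⟨a, fun x hx => ?_⟩
      rcases Finset.mem_insert.1 hx with rfl | hx
      · exact hmax z hz
      · obtain ⟨i, hi⟩ := hY z
        by_cases h : i = a
        · subst h; exact hi x hx
        · exact absurd (hi _ (m1 i)) (not_le.2 (hz i h))
    · push Not at hz
      obtain ⟨i, hia, hi⟩ := hz
      refine ⟨i, fun x hx => ?_⟩
      rcases Finset.mem_insert.1 hx with rfl | hx
      · exact hi.trans (hy i hia).le
      · exact hi.trans (m2 i x hx)

theorem max_of_door {I V : Type*} [Fintype I] [DecidableEq I] [Fintype V] [DecidableEq V]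
    {r : I → V → ℕ} (hinj : ∀ i, Function.Injective (r i))
    {Y : Finset V} (hY : Dom r Y) (hcard : Y.card + 1 = Fintype.card I)
    {m : I → V} (m1 : ∀ i, m i ∈ Y) (m2 : ∀ i, ∀ x ∈ Y, r i (m i) ≤ r i x)
    {a b : I} (hab : a ≠ b) (hm : m a = m b) {y : V}
    (hyY : y ∉ Y) (hD : Dom r (insert y Y)) :
    ∃ l, (l = a ∨ l = b) ∧ (∀ i, i ≠ l → r i (m i) < r i y) ∧
      (∀ z, (∀ i, i ≠ l → r i (m i) < r i z) → r l z ≤ r l y) := by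
  obtain ⟨q, q1, q2⟩ := exists_argmin (I := I) r (Finset.insert_nonempty y Y)
  have hqs : Finset.univ.image q = insert y Y := by
    ext v
    simp only [Finset.mem_image, Finset.mem_univ, true_and]
    constructor
    · rintro ⟨i, rfl⟩; exact q1 i
    · exact fun hv => hD.surj hinj q1 q2 hv
  have hqi : Set.InjOn q (Finset.univ : Finset I) := by
    apply Finset.injOn_of_card_image_eq
    rw [hqs, Finset.card_insert_of_notMem hyY, Finset.card_univ, hcard]
  obtain ⟨l, hl⟩ := hD.surj hinj q1 q2 (Finset.mem_insert_self y Y)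
  have hq : ∀ i, i ≠ l → q i = m i := by
    intro i hi
    have : q i ∈ Y := by
      rcases Finset.mem_insert.1 (q1 i) with h | h
      · exact absurd (hqi (by simp) (by simp) (h.trans hl.symm)) hi
      · exact h
    exact hinj i (le_antisymm (q2 i _ (Finset.mem_insert_of_mem (m1 i))) (m2 i _ this))
  have hM : ∀ i, i ≠ l → r i (m i) < r i y := by
    intro i hi
    refine lt_of_le_of_ne ?_ (fun h => hyY (hinj i h ▸ m1 i))
    rw [← hq i hi]; exact q2 i _ (Finset.mem_insert_self y Y)
  refine ⟨l, ?_, hM, ?_⟩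
  · by_contra hcon
    push Not at hcon
    have : q a = q b := by rw [hq a hcon.1.symm, hq b hcon.2.symm, hm]
    exact hab (hqi (by simp) (by simp) this)
  · intro z hz
    obtain ⟨i, hi⟩ := hD z
    by_cases h : i = l
    · subst h; exact hi _ (Finset.mem_insert_self y Y)
    · exact absurd (hi _ (Finset.mem_insert_of_mem (m1 i))) (not_le.2 (hz i h))

open Classical in
/-- both sides open: exactly two rooms -/
theorem door_two {I V : Type*} [Fintype I] [DecidableEq I] [Fintype V] [DecidableEq V]
    {r : I → V → ℕ} (hinj : ∀ i, Function.Injective (r i))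
    {Y : Finset V} (hY : Dom r Y) (hcard : Y.card + 1 = Fintype.card I)
    {m : I → V} (m1 : ∀ i, m i ∈ Y) (m2 : ∀ i, ∀ x ∈ Y, r i (m i) ≤ r i x)
    {a b : I} (hab : a ≠ b) (hm : m a = m b)
    (ha : ∃ y, ∀ i, i ≠ a → r i (m i) < r i y) (hb : ∃ y, ∀ i, i ≠ b → r i (m i) < r i y) :
    (Finset.univ.filter fun y => y ∉ Y ∧ Dom r (insert y Y)).card = 2 := by
  obtain ⟨ya, hya, hyam⟩ := Finset.exists_max_image
    (Finset.univ.filter fun y => ∀ i, i ≠ a → r i (m i) < r i y) (r a) (by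
      obtain ⟨y, hy⟩ := ha; exact ⟨y, by simpa using hy⟩)
  obtain ⟨yb, hyb, hybm⟩ := Finset.exists_max_image
    (Finset.univ.filter fun y => ∀ i, i ≠ b → r i (m i) < r i y) (r b) (by
      obtain ⟨y, hy⟩ := hb; exact ⟨y, by simpa using hy⟩)
  simp only [Finset.mem_filter, Finset.mem_univ, true_and] at hya hyam hyb hybm
  rw [Finset.card_eq_two]
  refine ⟨ya, yb, ?_, ?_⟩
  · rintro rfl
    obtain ⟨i, hi⟩ := hY ya
    have := hi _ (m1 i)
    by_cases h : i = a
    · exact absurd this (not_le.2 (hyb i (h ▸ hab)))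
    · exact absurd this (not_le.2 (hya i h))
  · ext y
    simp only [Finset.mem_filter, Finset.mem_univ, true_and, Finset.mem_insert,
      Finset.mem_singleton]
    constructor
    · rintro ⟨h1, h2⟩
      obtain ⟨l, rfl | rfl, h3, h4⟩ := max_of_door hinj hY hcard m1 m2 hab hm h1 h2
      · exact Or.inl (hinj l (le_antisymm (hyam _ h3) (h4 _ hya)))
      · exact Or.inr (hinj l (le_antisymm (hybm _ h3) (h4 _ hyb)))
    · rintro (rfl | rfl)
      · exact door_of_max hinj hY hcard m1 m2 hab hm hya hyam
      · exact door_of_max hinj hY hcard m1 m2 hab.symm hm.symm hyb hybm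

open Classical in
/-- one side open: exactly one room -/
theorem door_one {I V : Type*} [Fintype I] [DecidableEq I] [Fintype V] [DecidableEq V]
    {r : I → V → ℕ} (hinj : ∀ i, Function.Injective (r i))
    {Y : Finset V} (hY : Dom r Y) (hcard : Y.card + 1 = Fintype.card I)
    {m : I → V} (m1 : ∀ i, m i ∈ Y) (m2 : ∀ i, ∀ x ∈ Y, r i (m i) ≤ r i x)
    {a b : I} (hab : a ≠ b) (hm : m a = m b)
    (ha : ∃ y, ∀ i, i ≠ a → r i (m i) < r i y) (hb : ¬ ∃ y, ∀ i, i ≠ b → r i (m i) < r i y) :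
    (Finset.univ.filter fun y => y ∉ Y ∧ Dom r (insert y Y)).card = 1 := by
  obtain ⟨ya, hya, hyam⟩ := Finset.exists_max_image
    (Finset.univ.filter fun y => ∀ i, i ≠ a → r i (m i) < r i y) (r a) (by
      obtain ⟨y, hy⟩ := ha; exact ⟨y, by simpa using hy⟩)
  simp only [Finset.mem_filter, Finset.mem_univ, true_and] at hya hyam
  rw [Finset.card_eq_one]
  refine ⟨ya, ?_⟩
  ext y
  simp only [Finset.mem_filter, Finset.mem_univ, true_and, Finset.mem_singleton]
  constructor
  · rintro ⟨h1, h2⟩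
    obtain ⟨l, rfl | rfl, h3, h4⟩ := max_of_door hinj hY hcard m1 m2 hab hm h1 h2
    · exact hinj l (le_antisymm (hyam _ h3) (h4 _ hya))
    · exact absurd ⟨y, h3⟩ hb
  · rintro rfl
    exact door_of_max hinj hY hcard m1 m2 hab hm hya hyam

open Classical in
theorem room_even {I V : Type*} [Fintype I] (c : V → I) (i₀ : I)
    {X : Finset V} (hcard : X.card = Fintype.card I) (hX : X.image c ≠ Finset.univ) :
    Even (X.filter fun x => (X.erase x).image c = Finset.univ.erase i₀).card := by
  by_cases hne : (X.filter fun x => (X.erase x).image c = Finset.univ.erase i₀).Nonempty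
  swap
  · rw [Finset.not_nonempty_iff_eq_empty.1 hne]; simp
  obtain ⟨x, hx⟩ := hne
  rw [Finset.mem_filter] at hx
  obtain ⟨hxX, hxd⟩ := hx
  have hcx : c x ≠ i₀ := by
    intro h
    apply hX
    rw [← Finset.insert_erase hxX, Finset.image_insert, hxd, h]
    exact Finset.insert_erase (Finset.mem_univ _)
  have : c x ∈ (X.erase x).image c := by rw [hxd]; simpa using hcx
  obtain ⟨x', hx', hcx'⟩ := Finset.mem_image.1 this
  have hinj : Set.InjOn c (X.erase x : Finset V) := by
    apply Finset.injOn_of_card_image_eq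
    rw [hxd, Finset.card_erase_of_mem (Finset.mem_univ _), Finset.card_erase_of_mem hxX, hcard,
      Finset.card_univ]
  have hne : x' ≠ x := (Finset.mem_erase.1 hx').1
  have hx'X : x' ∈ X := (Finset.mem_erase.1 hx').2
  have h2 : (X.filter fun x => (X.erase x).image c = Finset.univ.erase i₀) = {x, x'} := by
    ext w
    simp only [Finset.mem_filter, Finset.mem_insert, Finset.mem_singleton]
    constructor
    · rintro ⟨hw, hwd⟩
      by_contra hcon
      push Not at hcon
      have hwx : w ∈ X.erase x := Finset.mem_erase.2 ⟨hcon.1, hw⟩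
      have : c w ∈ (X.erase w).image c := by
        rw [hwd, ← hxd]; exact Finset.mem_image_of_mem c hwx
      obtain ⟨w', hw', hcw'⟩ := Finset.mem_image.1 this
      rw [Finset.mem_erase] at hw'
      by_cases h : w' = x
      · subst h
        exact hcon.2 (hinj hwx hx' (hcw'.symm.trans hcx'.symm))
      · exact hw'.1 (hinj (Finset.mem_erase.2 ⟨h, hw'.2⟩) hwx hcw')
    · rintro (rfl | rfl)
      · exact ⟨hxX, hxd⟩
      · refine ⟨hx'X, ?_⟩
        rw [← hxd]
        ext j
        simp only [Finset.mem_image, Finset.mem_erase]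
        constructor
        · rintro ⟨v, ⟨h1, h2⟩, rfl⟩
          by_cases h : v = x
          · subst h; exact ⟨w, ⟨hne, hx'X⟩, hcx'⟩
          · exact ⟨v, ⟨h, h2⟩, rfl⟩
        · rintro ⟨v, ⟨h1, h2⟩, rfl⟩
          by_cases h : v = w
          · subst h; exact ⟨x, ⟨hne.symm, hxX⟩, hcx'.symm⟩
          · exact ⟨v, ⟨h, h2⟩, rfl⟩
  rw [h2, Finset.card_pair hne.symm]
  exact even_two

open Classical in
theorem scarf {I V : Type*} [Fintype I] [Nontrivial I] [Fintype V]
    (r : I → V → ℕ) (hinj : ∀ i, Function.Injective (r i)) (s : I → V)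
    (hT : ∃ t, t ∉ Set.range s) (h1 : ∀ i v, r i (s i) ≤ r i v)
    (h2 : ∀ i j, i ≠ j → ∀ t, t ∉ Set.range s → r i t < r i (s j))
    (c : V → I) (hc : ∀ i, c (s i) = i) :
    ∃ X : Finset V, Dom r X ∧ X.image c = Finset.univ := by
  by_contra hcon
  push Not at hcon
  obtain ⟨i₀⟩ : Nonempty I := inferInstance
  have hn2 : 2 ≤ Fintype.card I := Fintype.one_lt_card
  have hsinj : Function.Injective s := fun a b h => by rw [← hc a, ← hc b, h]
  have hs1 : ∀ i v, v ≠ s i → r i (s i) < r i v := fun i v hv =>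
    lt_of_le_of_ne (h1 i v) (fun h => hv (hinj i h).symm)
  let Y₀ : Finset V := (Finset.univ.erase i₀).image s
  let A : Finset (Finset V × V) := Finset.univ.filter fun p =>
    (p.1.card + 1 = Fintype.card I ∧ p.1.image c = Finset.univ.erase i₀) ∧
      (p.2 ∉ p.1 ∧ Dom r (insert p.2 p.1))
  let B : Finset (Finset V × V) := Finset.univ.filter fun p =>
    (p.1.card = Fintype.card I ∧ Dom r p.1) ∧
      (p.2 ∈ p.1 ∧ (p.1.erase p.2).image c = Finset.univ.erase i₀)
  have hAB : A.card = B.card := by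
    apply Finset.card_nbij' (fun p => (insert p.2 p.1, p.2)) (fun p => (p.1.erase p.2, p.2))
    · rintro ⟨Y, y⟩ h
      simp only [A, B, Finset.coe_filter, Finset.mem_univ, true_and, Set.mem_ofPred_eq] at h ⊢
      refine ⟨⟨?_, h.2.2⟩, Finset.mem_insert_self _ _, ?_⟩
      · rw [Finset.card_insert_of_notMem h.2.1]; exact h.1.1
      · rw [Finset.erase_insert h.2.1]; exact h.1.2
    · rintro ⟨X, x⟩ h
      simp only [A, B, Finset.coe_filter, Finset.mem_univ, true_and, Set.mem_ofPred_eq] at h ⊢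
      refine ⟨⟨?_, h.2.2⟩, Finset.notMem_erase _ _, ?_⟩
      · rw [Finset.card_erase_add_one h.2.1]; exact h.1.1
      · rw [Finset.insert_erase h.2.1]; exact h.1.2
    · rintro ⟨Y, y⟩ h
      simp only [A, Finset.coe_filter, Finset.mem_univ, true_and, Set.mem_ofPred_eq] at h ⊢
      rw [Finset.erase_insert h.2.1]
    · rintro ⟨X, x⟩ h
      simp only [B, Finset.coe_filter, Finset.mem_univ, true_and, Set.mem_ofPred_eq] at h ⊢
      rw [Finset.insert_erase h.2.1]
  have hBsum : B.card = ∑ X : Finset V, (B.filter fun p => p.1 = X).card :=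
    Finset.card_eq_sum_card_fiberwise (fun _ _ => by simp)
  have hAsum : A.card = ∑ X : Finset V, (A.filter fun p => p.1 = X).card :=
    Finset.card_eq_sum_card_fiberwise (fun _ _ => by simp)
  have hB : Even B.card := by
    rw [hBsum]
    apply Finset.even_sum
    intro X _
    by_cases hX : X.card = Fintype.card I ∧ Dom r X
    · have hre := room_even c i₀ hX.1 (hcon X hX.2)
      refine (congrArg Even ?_).mpr hre
      apply Finset.card_nbij' (fun p => p.2) (fun x => (X, x))
      · rintro ⟨X', x⟩ h
        simp [B] at h ⊢
        obtain ⟨h, rfl⟩ := h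
        exact h.2
      · intro x h
        simp [B] at h ⊢
        exact ⟨hX, h⟩
      · rintro ⟨X', x⟩ h
        simp [B] at h ⊢
        exact h.2.symm
      · intro x h; rfl
    · have : (B.filter fun p => p.1 = X) = ∅ := by
        apply Finset.filter_eq_empty_iff.2
        rintro ⟨X', x⟩ h rfl
        simp [B] at h
        exact hX h.1
      rw [this]; simp
  have hfib : ∀ Y : Finset V, Y.card + 1 = Fintype.card I → Y.image c = Finset.univ.erase i₀ →
      (A.filter fun p => p.1 = Y).card =
        (Finset.univ.filter fun y => y ∉ Y ∧ Dom r (insert y Y)).card := by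
    intro Y hY1 hY2
    apply Finset.card_nbij' (fun p => p.2) (fun x => (Y, x))
    · rintro ⟨X', x⟩ h
      simp [A] at h ⊢
      obtain ⟨h, rfl⟩ := h
      exact h.2
    · intro x h
      simp [A] at h ⊢
      exact ⟨⟨hY1, hY2⟩, h⟩
    · rintro ⟨X', x⟩ h
      simp [A] at h ⊢
      exact h.2.symm
    · intro x h; rfl
  have hA1 : ∀ Y : Finset V, Y ≠ Y₀ → Even (A.filter fun p => p.1 = Y).card := by
    intro Y hYY
    by_cases hY : Y.card + 1 = Fintype.card I ∧ Y.image c = Finset.univ.erase i₀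
    swap
    · have : (A.filter fun p => p.1 = Y) = ∅ := by
        apply Finset.filter_eq_empty_iff.2
        rintro ⟨X', x⟩ h rfl
        simp [A] at h
        exact hY h.1
      rw [this]; simp
    obtain ⟨hY1, hY2⟩ := hY
    rw [hfib Y hY1 hY2]
    by_cases hD : Dom r Y
    swap
    · have : (Finset.univ.filter fun y => y ∉ Y ∧ Dom r (insert y Y)) = ∅ := by
        apply Finset.filter_eq_empty_iff.2
        rintro y - ⟨_, h⟩
        exact hD (h.mono (Finset.subset_insert _ _))
      rw [this]; simp
    have hne : Y.Nonempty := Finset.card_pos.1 (by omega)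
    obtain ⟨t, htY, ht⟩ : ∃ t ∈ Y, t ∉ Set.range s := by
      by_contra hno
      push Not at hno
      apply hYY
      ext y
      simp only [Y₀, Finset.mem_image]
      constructor
      · intro hy
        obtain ⟨i, rfl⟩ := hno y hy
        refine ⟨i, ?_, rfl⟩
        rw [← hY2, Finset.mem_image]
        exact ⟨s i, hy, hc i⟩
      · rintro ⟨i, hi, rfl⟩
        rw [← hY2, Finset.mem_image] at hi
        obtain ⟨v, hv, hvi⟩ := hi
        obtain ⟨j, rfl⟩ := hno v hv
        rw [hc] at hvi
        rwa [← hvi]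
    obtain ⟨m, m1, m2⟩ := exists_argmin (I := I) r hne
    obtain ⟨a, b, hab, hm⟩ := door_pair hinj hD hY1 m1 m2
    have key : ∀ l, ∃ y, ∀ i, i ≠ l → r i (m i) < r i y := fun l =>
      ⟨s l, fun i hi => (m2 i t htY).trans_lt (h2 i l hi t ht)⟩
    rw [door_two hinj hD hY1 m1 m2 hab hm (key a) (key b)]
    exact even_two
  have hA0 : (A.filter fun p => p.1 = Y₀).card = 1 := by
    have hY1 : Y₀.card + 1 = Fintype.card I := by
      rw [Finset.card_image_of_injective _ hsinj, Finset.card_erase_of_mem (Finset.mem_univ _),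
        Finset.card_univ]
      omega
    have hY2 : Y₀.image c = Finset.univ.erase i₀ := by
      simp only [Y₀, Finset.image_image]
      have : c ∘ s = id := funext hc
      rw [this, Finset.image_id]
    have hmem : ∀ i, i ≠ i₀ → s i ∈ Y₀ := fun i hi =>
      Finset.mem_image_of_mem s (by simpa using hi)
    have hmem' : ∀ y ∈ Y₀, ∃ i, i ≠ i₀ ∧ s i = y := by
      intro y hy
      obtain ⟨i, hi, rfl⟩ := Finset.mem_image.1 hy
      exact ⟨i, by simpa using hi, rfl⟩
    have hD : Dom r Y₀ := by
      intro z
      by_cases hz : z ∈ Set.range s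
      · obtain ⟨i, rfl⟩ := hz
        exact ⟨i, fun x _ => h1 i x⟩
      · refine ⟨i₀, fun x hx => ?_⟩
        obtain ⟨i, hi, rfl⟩ := hmem' x hx
        exact (h2 i₀ i hi.symm z hz).le
    have hne : Y₀.Nonempty := Finset.card_pos.1 (by omega)
    rw [hfib _ hY1 hY2]
    obtain ⟨m, m1, m2⟩ := exists_argmin (I := I) r hne
    have hms : ∀ i, i ≠ i₀ → m i = s i := fun i hi =>
      hinj i (le_antisymm (m2 i _ (hmem i hi)) (h1 i _))
    obtain ⟨a, ha, hma⟩ := hmem' _ (m1 i₀)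
    refine door_one hinj hD hY1 m1 m2 (a := i₀) (b := a) ha.symm ?_ ?_ ?_
    · rw [hms a ha, hma]
    · obtain ⟨t, ht⟩ := hT
      refine ⟨t, fun i hi => ?_⟩
      rw [hms i hi]
      exact hs1 i t (fun h => ht ⟨i, h.symm⟩)
    · rintro ⟨z, hz⟩
      have hz0 := hz i₀ ha.symm
      rw [← hma] at hz0
      by_cases hzs : z ∈ Set.range s
      · obtain ⟨i, rfl⟩ := hzs
        by_cases hi : i = i₀
        · subst hi; exact absurd hz0 (not_lt.2 (h1 _ _))
        · by_cases hia : i = a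
          · subst hia; exact lt_irrefl _ hz0
          · have := hz i hia
            rw [hms i hi] at this
            exact lt_irrefl _ this
      · exact absurd hz0 (not_lt.2 (h2 i₀ a ha.symm z hzs).le)
  have hA : Odd A.card := by
    rw [hAsum, ← Finset.add_sum_erase _ _ (Finset.mem_univ Y₀), hA0]
    apply Odd.add_even odd_one
    apply Finset.even_sum
    intro Y hY
    exact hA1 Y (Finset.ne_of_mem_erase hY)
  rw [hAB] at hA
  exact (Nat.not_even_iff_odd.2 hA) hB

open Classical in
theorem approx_zero {P : Type*} [Fintype P] [Nontrivial P] (h : (P → ℝ) → P → ℝ)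
    (hsum : ∀ z ∈ stdSimplex ℝ P, ∑ p, h z p = 0) (N : ℕ) (hN : 0 < N) :
    ∃ w ∈ stdSimplex ℝ P, ∀ i, w i ≤ (Fintype.card P : ℝ) / N ∨
      ∃ v ∈ stdSimplex ℝ P, (∀ j, |v j - w j| ≤ (Fintype.card P : ℝ) / N) ∧ 0 ≤ h v i := by
  let T := {a : P → Fin (N + 1) // ∑ p, (a p : ℕ) = N}
  let e := Fintype.equivFin T
  let e' := Fintype.equivFin P
  set M := Fintype.card T with hM
  let r : P → T ⊕ P → ℕ := fun i => Sum.elim (fun a => 1 + ((a.1 i : ℕ) * M + (e a : ℕ)))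
    (fun j => if j = i then 0 else (N + 1) * M + 1 + (e' j : ℕ))
  have hbd : ∀ (a : T) (i : P), (a.1 i : ℕ) * M + (e a : ℕ) < (N + 1) * M := by
    intro a i
    have h1 : (a.1 i : ℕ) ≤ N := Nat.lt_succ_iff.1 (a.1 i).2
    have h2 := (e a).2
    calc _ < (a.1 i : ℕ) * M + M := by omega
      _ = ((a.1 i : ℕ) + 1) * M := by ring
      _ ≤ _ := Nat.mul_le_mul_right _ (by omega)
  have hlex : ∀ (a b : T) (i : P), (a.1 i : ℕ) * M + (e a : ℕ) ≤ (b.1 i : ℕ) * M + (e b : ℕ) →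
      (a.1 i : ℕ) ≤ b.1 i := by
    intro a b i hab
    by_contra hlt
    push Not at hlt
    have h2 := (e b).2
    have : ((b.1 i : ℕ) + 1) * M ≤ (a.1 i : ℕ) * M := Nat.mul_le_mul_right _ hlt
    rw [add_mul, one_mul] at this
    omega
  have mk : ∀ f : P → ℕ, ∑ p, f p = N → ∃ a : T, ∀ p, (a.1 p : ℕ) = f p := by
    intro f hf
    have hle : ∀ p, f p < N + 1 := fun p => by
      have := Finset.single_le_sum (f := f) (fun i _ => Nat.zero_le _) (Finset.mem_univ p)
      omega
    exact ⟨⟨fun p => ⟨f p, hle p⟩, hf⟩, fun p => rfl⟩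
  obtain ⟨p₀⟩ : Nonempty P := inferInstance
  obtain ⟨t₀, -⟩ := mk (Pi.single p₀ N) (by simp)
  have hN' : (0 : ℝ) < N := by exact_mod_cast hN
  let pt : T → P → ℝ := fun a p => ((a.1 p : ℕ) : ℝ) / N
  have hpt : ∀ a, pt a ∈ stdSimplex ℝ P := by
    intro a
    refine ⟨fun p => by positivity, ?_⟩
    simp only [pt]
    rw [← Finset.sum_div, ← Nat.cast_sum, a.2, div_self hN'.ne']
  have hcol : ∀ a : T, ∃ p, 0 ≤ h (pt a) p := by
    intro a
    by_contra hcon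
    push Not at hcon
    have := Finset.sum_lt_sum_of_nonempty (s := Finset.univ) ⟨p₀, Finset.mem_univ _⟩
      (fun p _ => hcon p)
    rw [hsum _ (hpt a)] at this
    simp at this
  choose col hcol using hcol
  let c : T ⊕ P → P := Sum.elim col id
  obtain ⟨X, hX, hXc⟩ := scarf r (by
      intro i u v huv
      rcases u with a | j <;> rcases v with b | l
      · simp only [r, Sum.elim_inl] at huv
        have h1 := hlex a b i (by omega)
        have h2 := hlex b a i (by omega)
        have h3 := le_antisymm h1 h2
        rw [h3] at huv
        have : e a = e b := Fin.ext (by omega)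
        rw [e.injective this]
      · have := hbd a i
        simp only [r, Sum.elim_inl, Sum.elim_inr] at huv
        split_ifs at huv <;> omega
      · have := hbd b i
        simp only [r, Sum.elim_inl, Sum.elim_inr] at huv
        split_ifs at huv <;> omega
      · simp only [r, Sum.elim_inr] at huv
        split_ifs at huv with h1 h2 h2
        · rw [h1, h2]
        · omega
        · omega
        · have : e' j = e' l := Fin.ext (by omega)
          rw [e'.injective this]) Sum.inr ⟨Sum.inl t₀, by simp⟩ (by intro i v; simp [r])
      (by
        rintro i j hij (a | l) ht
        · have := hbd a i
          simp only [r, Sum.elim_inl, Sum.elim_inr]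
          rw [if_neg hij.symm]; omega
        · simp at ht) c (fun i => rfl)
  -- dominance by an index forces the slack to be absent
  have hdom : ∀ b : T, ∃ i, Sum.inr i ∉ X ∧ ∀ a : T, Sum.inl a ∈ X → (b.1 i : ℕ) ≤ a.1 i := by
    intro b
    obtain ⟨i, hi⟩ := hX (Sum.inl b)
    refine ⟨i, fun hmem => ?_, fun a ha => ?_⟩
    · have := hi _ hmem
      simp [r] at this
    · have := hi _ ha
      simp only [r, Sum.elim_inl] at this
      exact hlex b a i (by omega)
  have hcover : ∀ i, Sum.inr i ∉ X → ∃ a : T, Sum.inl a ∈ X ∧ col a = i := by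
    intro i hi
    have : i ∈ X.image c := by rw [hXc]; exact Finset.mem_univ _
    obtain ⟨u, hu, hui⟩ := Finset.mem_image.1 this
    rcases u with a | j
    · exact ⟨a, hu, hui⟩
    · have : j = i := hui
      exact absurd (this ▸ hu) hi
  obtain ⟨i₁, hi₁, -⟩ := hdom t₀
  obtain ⟨w, hw, -⟩ := hcover i₁ hi₁
  have hmin : ∀ i, ∃ a : T, Sum.inl a ∈ X ∧ ∀ b : T, Sum.inl b ∈ X → (a.1 i : ℕ) ≤ b.1 i := by
    intro i
    obtain ⟨a, ha, ham⟩ := Finset.exists_min_image (Finset.univ.filter fun a : T => Sum.inl a ∈ X)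
      (fun a => (a.1 i : ℕ)) ⟨w, by simpa using hw⟩
    simp only [Finset.mem_filter, Finset.mem_univ, true_and] at ha ham
    exact ⟨a, ha, ham⟩
  choose am ham hamin using hmin
  let m : P → ℕ := fun i => ((am i).1 i : ℕ)
  let C : Finset P := Finset.univ.filter fun i => Sum.inr i ∉ X
  have hCn : C.card ≤ Fintype.card P := Finset.card_le_univ _
  have hbig : N < ∑ i ∈ C, m i + C.card := by
    by_contra hle
    push Not at hle
    obtain ⟨b, hb⟩ := mk (fun i => (if i ∈ C then m i + 1 else 0) +
      (if i = i₁ then N - (∑ i ∈ C, m i + C.card) else 0)) (by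
        rw [Finset.sum_add_distrib, Finset.sum_ite_mem, Finset.univ_inter,
          Finset.sum_add_distrib, Finset.sum_ite_eq']
        simp
        omega)
    obtain ⟨i, hi, hib⟩ := hdom b
    have h1 := hib _ (ham i)
    rw [hb, if_pos (by simpa [C] using hi)] at h1
    simp only [m] at h1
    omega
  have hCsum : ∀ a : T, ∑ i ∈ C, (a.1 i : ℕ) + ∑ i ∈ Cᶜ, (a.1 i : ℕ) = N := fun a => by
    rw [Finset.sum_add_sum_compl]; exact a.2
  have hup : ∀ a : T, Sum.inl a ∈ X → ∀ i ∈ C, (a.1 i : ℕ) ≤ m i + Fintype.card P := by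
    intro a ha i hi
    have h1 := hCsum a
    have h2 := Finset.add_sum_erase C (fun i => (a.1 i : ℕ)) hi
    have h3 := Finset.add_sum_erase C m hi
    have h4 : ∑ j ∈ C.erase i, m j ≤ ∑ j ∈ C.erase i, (a.1 j : ℕ) :=
      Finset.sum_le_sum fun j _ => hamin j a ha
    omega
  have hout : ∀ a : T, Sum.inl a ∈ X → ∀ i, i ∉ C → (a.1 i : ℕ) ≤ Fintype.card P := by
    intro a ha i hi
    have h1 := hCsum a
    have h2 : (a.1 i : ℕ) ≤ ∑ i ∈ Cᶜ, (a.1 i : ℕ) :=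
      Finset.single_le_sum (f := fun i => (a.1 i : ℕ)) (fun _ _ => Nat.zero_le _)
        (by simpa using hi)
    have h4 : ∑ j ∈ C, m j ≤ ∑ j ∈ C, (a.1 j : ℕ) :=
      Finset.sum_le_sum fun j _ => hamin j a ha
    omega
  refine ⟨pt w, hpt w, fun i => ?_⟩
  by_cases hi : i ∈ C
  · right
    obtain ⟨v, hv, hvi⟩ := hcover i (by simpa [C] using hi)
    refine ⟨pt v, hpt v, fun j => ?_, hvi ▸ hcol v⟩
    have hd : ((v.1 j : ℕ) : ℝ) ≤ (w.1 j : ℕ) + Fintype.card P ∧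
        ((w.1 j : ℕ) : ℝ) ≤ (v.1 j : ℕ) + Fintype.card P := by
      by_cases hj : j ∈ C
      · have h1 := hup v hv j hj
        have h2 := hup w hw j hj
        have h3 : m j ≤ _ := hamin j v hv
        have h4 : m j ≤ _ := hamin j w hw
        constructor
        · exact_mod_cast (by omega : (v.1 j : ℕ) ≤ (w.1 j : ℕ) + Fintype.card P)
        · exact_mod_cast (by omega : (w.1 j : ℕ) ≤ (v.1 j : ℕ) + Fintype.card P)
      · have h1 := hout v hv j hj
        have h2 := hout w hw j hj
        constructor
        · exact_mod_cast (by omega : (v.1 j : ℕ) ≤ (w.1 j : ℕ) + Fintype.card P)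
        · exact_mod_cast (by omega : (w.1 j : ℕ) ≤ (v.1 j : ℕ) + Fintype.card P)
    simp only [pt]
    rw [← sub_div, abs_div, abs_of_pos hN']
    apply div_le_div_of_nonneg_right _ hN'.le
    rw [abs_le]
    constructor <;> linarith [hd.1, hd.2]
  · left
    simp only [pt]
    apply div_le_div_of_nonneg_right _ hN'.le
    exact_mod_cast hout w hw i hi

open Filter Topology in
theorem exists_zero {P : Type*} [Fintype P] [Nonempty P] (h : (P → ℝ) → P → ℝ)
    (hcont : Continuous h)
    (hsum : ∀ z ∈ stdSimplex ℝ P, ∑ p, h z p = 0)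
    (hbd : ∀ z ∈ stdSimplex ℝ P, ∀ p, z p = 0 → 0 ≤ h z p) :
    ∃ z ∈ stdSimplex ℝ P, ∀ p, h z p = 0 := by
  classical
  suffices hs : ∃ z ∈ stdSimplex ℝ P, ∀ p, 0 ≤ h z p by
    obtain ⟨z, hz, hp⟩ := hs
    refine ⟨z, hz, fun p => ?_⟩
    exact (Finset.sum_eq_zero_iff_of_nonneg (fun p _ => hp p)).1 (hsum z hz) p (Finset.mem_univ p)
  rcases subsingleton_or_nontrivial P with hP | hP
  · obtain ⟨p₀⟩ : Nonempty P := inferInstance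
    refine ⟨Pi.single p₀ 1, single_mem_stdSimplex ℝ p₀, fun p => ?_⟩
    have := hsum _ (single_mem_stdSimplex ℝ p₀)
    rw [Fintype.sum_subsingleton _ p] at this
    exact this.ge
  have happ := fun N : ℕ => approx_zero h hsum (N + 1) (Nat.succ_pos N)
  choose w hw hwi using happ
  obtain ⟨z, hz, φ, hφ, hlim⟩ := (isCompact_stdSimplex ℝ P).tendsto_subseq hw
  have hε : Tendsto (fun N : ℕ => (Fintype.card P : ℝ) / ((φ N + 1 : ℕ) : ℝ)) atTop (𝓝 0) := by
    have h1 : Tendsto (fun N : ℕ => (Fintype.card P : ℝ) / (N : ℝ)) atTop (𝓝 0) :=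
      tendsto_const_div_atTop_nhds_zero_nat _
    exact h1.comp ((tendsto_add_atTop_nat 1).comp hφ.tendsto_atTop)
  refine ⟨z, hz, fun p => ?_⟩
  rcases (hz.1 p).eq_or_lt with h0 | hpos
  · exact hbd z hz p h0.symm
  have hlimc : ∀ q, Tendsto (fun N => w (φ N) q) atTop (𝓝 (z q)) := fun q =>
    (tendsto_pi_nhds.1 hlim) q
  have hev : ∀ᶠ N in atTop, (Fintype.card P : ℝ) / ((φ N + 1 : ℕ) : ℝ) < w (φ N) p :=
    hε.eventually_lt (hlimc p) hpos
  have hex : ∀ N, ∃ v : P → ℝ, (Fintype.card P : ℝ) / ((φ N + 1 : ℕ) : ℝ) < w (φ N) p →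
      (∀ j, |v j - w (φ N) j| ≤ (Fintype.card P : ℝ) / ((φ N + 1 : ℕ) : ℝ)) ∧ 0 ≤ h v p := by
    intro N
    rcases hwi (φ N) p with h1 | ⟨v, _, h2⟩
    · exact ⟨0, fun h3 => absurd h1 (not_le.2 h3)⟩
    · exact ⟨v, fun _ => h2⟩
  choose v hv using hex
  have hvlim : Tendsto v atTop (𝓝 z) := by
    rw [tendsto_pi_nhds]
    intro q
    have h1 : Tendsto (fun N => v N q - w (φ N) q) atTop (𝓝 0) := by
      apply squeeze_zero_norm' _ hε
      filter_upwards [hev] with N hN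
      exact (hv N hN).1 q
    simpa using h1.add (hlimc q)
  have h2 : Tendsto (fun N => h (v N) p) atTop (𝓝 (h z p)) :=
    (((continuous_apply p).comp hcont).tendsto z).comp hvlim
  apply ge_of_tendsto h2
  filter_upwards [hev] with N hN
  exact (hv N hN).2

open Classical in
theorem expectedPayoff_update {k : ℕ} {S : Fin k → Type*} [∀ i, Fintype (S i)]
    (u : (∀ i, S i) → ℝ) (x : ∀ i, S i → ℝ) (i : Fin k) (y : S i → ℝ) :
    expectedPayoff u (Function.update x i y) =
      ∑ a, y a * expectedPayoff u (Function.update x i (Pi.single a 1)) := by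
  have key : ∀ (y : S i → ℝ) (s : ∀ i, S i), ∏ j, (Function.update x i y) j (s j) =
      y (s i) * ∏ j ∈ Finset.univ.erase i, x j (s j) := by
    intro y s
    rw [← Finset.mul_prod_erase _ _ (Finset.mem_univ i), Function.update_self]
    congr 1
    apply Finset.prod_congr rfl
    intro j hj
    rw [Function.update_of_ne (Finset.ne_of_mem_erase hj)]
  simp only [expectedPayoff, key]
  simp only [Finset.mul_sum]
  rw [Finset.sum_comm]
  apply Finset.sum_congr rfl
  intro s _
  rw [Finset.sum_eq_single (s i)]
  · simp; ring
  · intro a _ ha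
    rw [Pi.single_eq_of_ne ha.symm]; ring
  · simp

theorem IsMixed.sum_const {σ : Type*} [Fintype σ] {x : σ → ℝ} (hx : IsMixed x) (r : ℝ) :
    ∑ a, x a * r = r := by
  rw [← Finset.sum_mul, hx.2, one_mul]

/-- **Nash's theorem**: every finite k-player game has a Nash equilibrium in
mixed strategies. -/
theorem exists_nash_equilibrium {k : ℕ} (S : Fin k → Type*)
    [∀ i, Fintype (S i)] [∀ i, Nonempty (S i)]
    (u : ∀ i : Fin k, (∀ i, S i) → ℝ) :
    ∃ x : ∀ i, S i → ℝ, IsProfile x ∧ IsNashEquilibrium u x := by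
  classical
  let x : ((∀ i, S i) → ℝ) → ∀ i, S i → ℝ := fun z i a => ∑ p, if p i = a then z p else 0
  have hxc : Continuous x := by
    refine continuous_pi fun i => continuous_pi fun a => continuous_finsetSum _ fun p _ => ?_
    split_ifs
    · exact continuous_apply p
    · exact continuous_const
  have hsumx : ∀ z i (f : S i → ℝ), ∑ p, z p * f (p i) = ∑ a, x z i a * f a := by
    intro z i f
    simp only [x, Finset.sum_mul]
    rw [Finset.sum_comm]
    refine Finset.sum_congr rfl fun p _ => ?_
    simp [ite_mul]
  have hxm : ∀ z ∈ stdSimplex ℝ (∀ i, S i), IsProfile (x z) := by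
    intro z hz i
    refine ⟨fun a => Finset.sum_nonneg fun p _ => ?_, ?_⟩
    · split_ifs
      · exact hz.1 p
      · exact le_rfl
    · have := hsumx z i (fun _ => 1)
      simp only [mul_one] at this
      rw [← this, hz.2]
  let D : ((∀ i, S i) → ℝ) → ∀ i, S i → ℝ := fun z i a =>
    expectedPayoff (u i) (Function.update (x z) i (Pi.single a 1)) - expectedPayoff (u i) (x z)
  have hUc : ∀ i, Continuous (fun y : ∀ i, S i → ℝ => expectedPayoff (u i) y) := by
    intro i
    unfold expectedPayoff
    fun_prop
  have hDc : ∀ i a, Continuous (fun z => D z i a) := by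
    intro i a
    exact ((hUc i).comp (hxc.update i continuous_const)).sub ((hUc i).comp hxc)
  have hD0 : ∀ z ∈ stdSimplex ℝ (∀ i, S i), ∀ i, ∑ a, x z i a * D z i a = 0 := by
    intro z hz i
    simp only [D, mul_sub, Finset.sum_sub_distrib]
    rw [← expectedPayoff_update, Function.update_eq_self, (hxm z hz i).sum_const, sub_self]
  let G : ((∀ i, S i) → ℝ) → (∀ i, S i) → ℝ := fun z p => ∑ i, D z i (p i)
  have hGc : ∀ p, Continuous (fun z => G z p) := fun p =>
    continuous_finsetSum _ fun i _ => hDc i (p i)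
  have hG0 : ∀ z ∈ stdSimplex ℝ (∀ i, S i), ∑ p, z p * G z p = 0 := by
    intro z hz
    simp only [G, Finset.mul_sum]
    rw [Finset.sum_comm]
    refine Finset.sum_eq_zero fun i _ => ?_
    rw [hsumx z i (fun a => D z i a), hD0 z hz i]
  obtain ⟨z, hz, hzero⟩ := exists_zero
    (fun z p => max (G z p) 0 - z p * ∑ q, max (G z q) 0)
    (by
      refine continuous_pi fun p => ?_
      refine ((hGc p).max continuous_const).sub ((continuous_apply p).mul ?_)
      exact continuous_finsetSum _ fun q _ => (hGc q).max continuous_const)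
    (by
      intro z hz
      rw [Finset.sum_sub_distrib, ← Finset.sum_mul, hz.2, one_mul, sub_self])
    (by
      intro z _ p hp
      simp [hp])
  have hGle : ∀ p, G z p ≤ 0 := by
    set R := ∑ q, max (G z q) 0 with hR
    have hR0 : 0 ≤ R := Finset.sum_nonneg fun q _ => le_max_right _ _
    rcases hR0.eq_or_lt with h0 | hpos
    · intro p
      have := hzero p
      simp only [← h0, mul_zero, sub_zero] at this
      exact (le_max_left _ _).trans this.le
    · exfalso
      have hterm : ∀ p, z p * G z p = z p * (z p * R) := by
        intro p
        have h1 := hzero p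
        rcases (hz.1 p).eq_or_lt with h2 | h2
        · rw [← h2]; simp
        · have h3 : 0 < max (G z p) 0 := by
            have := mul_pos h2 hpos
            linarith
          have h4 : max (G z p) 0 = G z p := by
            apply max_eq_left
            by_contra hlt
            rw [max_eq_right (not_le.1 hlt).le] at h3
            exact lt_irrefl _ h3
          rw [h4] at h1
          congr 1; linarith
      have h5 := hG0 z hz
      simp only [hterm] at h5
      have h6 := (Finset.sum_eq_zero_iff_of_nonneg
        (fun p _ => mul_nonneg (hz.1 p) (mul_nonneg (hz.1 p) hpos.le))).1 h5
      have h7 : ∀ p, z p = 0 := by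
        intro p
        have := h6 p (Finset.mem_univ p)
        simpa [hpos.ne'] using this
      have h8 := hz.2
      simp [h7] at h8
  have hbest : ∀ i, ∃ a, 0 ≤ D z i a := by
    intro i
    by_contra hcon
    push Not at hcon
    have h1 := hD0 z hz i
    have h2 : ∀ a, x z i a = 0 := by
      intro a
      have h3 := (Finset.sum_eq_zero_iff_of_nonpos
        (fun a _ => mul_nonpos_of_nonneg_of_nonpos ((hxm z hz i).1 a) (hcon a).le)).1 h1 a
          (Finset.mem_univ a)
      exact (mul_eq_zero.1 h3).resolve_right (hcon a).ne
    have h4 := (hxm z hz i).2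
    simp [h2] at h4
  choose b hb using hbest
  have hDle : ∀ i a, D z i a ≤ 0 := by
    intro i a
    have h1 := hGle (Function.update b i a)
    simp only [G] at h1
    rw [← Finset.add_sum_erase _ _ (Finset.mem_univ i), Function.update_self] at h1
    have h2 : 0 ≤ ∑ j ∈ Finset.univ.erase i, D z j (Function.update b i a j) := by
      refine Finset.sum_nonneg fun j hj => ?_
      rw [Function.update_of_ne (Finset.ne_of_mem_erase hj)]
      exact hb j
    linarith
  refine ⟨x z, hxm z hz, fun i y hy => ?_⟩
  rw [expectedPayoff_update]
  calc _ ≤ ∑ a, y a * expectedPayoff (u i) (x z) := by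
        refine Finset.sum_le_sum fun a _ => mul_le_mul_of_nonneg_left ?_ (hy.1 a)
        have := hDle i a
        simp only [D] at this
        linarith
    _ = _ := hy.sum_const _
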